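/- Exact solution of the degenerate model problem: with c = (√5 - 1)/2 and u(x) = x^c / c - x (real power), for every x ∈ (0,1) one has -(deriv (fun y => y² * deriv u y)) x + u x = x, and moreover the natural boundary condition deriv u 1 = 0 holds. -/

import Mathlib

theorem Real.hasDerivAt_rpow_div_sub_id {c x : ℝ} (hc : c ≠ 0) (hx : x ≠ 0) :
    HasDerivAt (fun y : ℝ => y ^ c / c - y) (x ^ (c - 1) - 1) x := by
  have h := ((Real.hasDerivAt_rpow_const (p := c) (Or.inl hx)).div_const c).sub (hasDerivAt_id x)
  rwa [mul_div_cancel_left₀ _ hc] at h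

theorem degenerate_model_exact_solution
    (c : ℝ) (hc : c = (Real.sqrt 5 - 1) / 2)
    (u : ℝ → ℝ) (hu : ∀ x : ℝ, u x = x ^ c / c - x) :
    (∀ x ∈ Set.Ioo (0 : ℝ) 1,
      -(deriv (fun y : ℝ => y ^ 2 * deriv u y)) x + u x = x) ∧
    deriv u 1 = 0 := by
  have hquad : c ^ 2 + c = 1 := by
    have h5 : Real.sqrt 5 ^ 2 = 5 := Real.sq_sqrt (by norm_num)
    rw [hc]
    linear_combination h5 / 4
  have hc0 : c ≠ 0 := by
    rintro rfl
    norm_num at hquad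
  obtain rfl : u = fun x => x ^ c / c - x := funext hu
  refine ⟨fun x hx => ?_, ?_⟩
  · have hx0 : 0 < x := hx.1
    have hflux : (fun y : ℝ => y ^ 2 * deriv (fun x : ℝ => x ^ c / c - x) y)
        =ᶠ[nhds x] fun y => y ^ (c + 1) - y ^ 2 := by
      filter_upwards [lt_mem_nhds hx0] with y hy
      have hpow : y ^ (c + 1) = y ^ 2 * y ^ (c - 1) := by
        rw [← Real.rpow_natCast y 2, ← Real.rpow_add hy]
        congr 1
        push_cast
        ring
      rw [(Real.hasDerivAt_rpow_div_sub_id hc0 hy.ne').deriv, hpow]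
      ring
    have hderiv : HasDerivAt (fun y : ℝ => y ^ (c + 1) - y ^ 2) ((c + 1) * x ^ c - 2 * x) x := by
      have h := (Real.hasDerivAt_rpow_const (p := c + 1) (Or.inl hx0.ne')).sub (hasDerivAt_pow 2 x)
      exact h.congr_deriv (by simp)
    rw [hflux.deriv_eq, hderiv.deriv]
    field_simp
    linear_combination -x ^ c * hquad
  · rw [(Real.hasDerivAt_rpow_div_sub_id hc0 one_ne_zero).deriv, Real.one_rpow, sub_self]
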